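/- Let H and K be real constants and let φ(x₃) = α x₃ + β x₃² + γ x₃³ with α > 0. If the polynomial identity φ'(x₃)²·(1 + 4Hφ(x₃) + (4H² + 2K)φ(x₃)²) = 1 holds modulo terms of order x₃³, then α = 1, β = −H, and γ = (6H² − K)/3. -/

import Mathlib

open Polynomial

/-- Proposition (prop-phip): if `φ(x₃) = α x₃ + β x₃² + γ x₃³` with `α > 0` and
the polynomial `φ'² (1 + 4Hφ + (4H² + 2K)φ²)` agrees with `1` in the
coefficients of `x₃⁰, x₃¹, x₃²`, then `α = 1`, `β = −H`, `γ = (6H² − K)/3`. -/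
theorem incompressibility_coeffs (H K α β γ : ℝ) (hα : 0 < α)
    (φp : Polynomial ℝ)
    (hφp : φp = C α * X + C β * X ^ 2 + C γ * X ^ 3)
    (hconstraint : ∀ k : ℕ, k < 3 →
      ((derivative φp) ^ 2 *
        (1 + C (4 * H) * φp + C (4 * H ^ 2 + 2 * K) * φp ^ 2)).coeff k =
      (1 : Polynomial ℝ).coeff k) :
    α = 1 ∧ β = -H ∧ γ = (6 * H ^ 2 - K) / 3 := by
  have c0 : φp.coeff 0 = 0 := by simp [hφp]
  have c1 : φp.coeff 1 = α := by simp [hφp, coeff_X_pow]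
  have c2 : φp.coeff 2 = β := by simp [hφp, coeff_X_pow]
  have c3 : φp.coeff 3 = γ := by simp [hφp, coeff_X_pow]
  have h0 := hconstraint 0 (by norm_num)
  have h1 := hconstraint 1 (by norm_num)
  have h2 := hconstraint 2 (by norm_num)
  clear hφp hconstraint
  simp [sq, coeff_mul, Finset.Nat.antidiagonal_succ, coeff_derivative, coeff_one,
    c0, c1, c2, c3] at h0 h1 h2
  have hα1 : α = 1 := by nlinarith
  subst hα1
  have hβ : β = -H := by linarith
  subst hβ
  exact ⟨rfl, rfl, by linarith⟩
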